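/- arXiv:2208.14152 — 9 statements merged into one kernel-verified Lean document; each statement's English description precedes it below -/
import Mathlib

section
/- Let r, κ, θ, λ̄, σ, ρ be real numbers, let γ < 1 with γ ≠ 0, and let T ∈ ℝ. Set k₀ = γλ̄²/(1−γ), k₁ = κ − γλ̄σρ/(1−γ), k₂ = σ² + γσ²ρ²/(1−γ). Let a, b : ℝ → ℝ be differentiable functions satisfying, for all t ∈ ℝ, b'(t) = −(½k₂ b(t)² − k₁ b(t) + ½k₀) and a'(t) = −(κθ b(t) + γ r), together with a(T) = 0 and b(T) = 0. Define V : ℝ × (0,∞) × ℝ → ℝ by V(t,y,v) = (y^γ/γ)·exp(a(t) + b(t)·v). Then V(T,y,v) = y^γ/γ for all y > 0, and for all t ∈ ℝ, y > 0, v ∈ ℝ one has ∂_{yy}V(t,y,v) ≠ 0 and ∂_t V + κθ ∂_v V + y r ∂_y V + v·( ½σ² ∂_{vv}V − κ ∂_v V − (λ̄ ∂_y V + σρ ∂_{yv}V)² / (2 ∂_{yy}V) ) = 0. -/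
theorem deriv_const_mul_exp_affine (c α β v : ℝ) :
    deriv (fun w => c * Real.exp (α + β * w)) v = c * β * Real.exp (α + β * v) := by
  have h : HasDerivAt (fun w => α + β * w) β v := by
    simpa using ((hasDerivAt_id v).const_mul β).const_add α
  rw [(h.exp.const_mul c).deriv]
  ring

theorem deriv_const_mul_rpow_mul_const (c p d : ℝ) {y : ℝ} (hy : 0 < y) :
    deriv (fun x : ℝ => c * x ^ p * d) y = c * p * y ^ (p - 1) * d := by
  rw [(((Real.hasDerivAt_rpow_const (Or.inl hy.ne')).const_mul c).mul_const d).deriv]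
  ring


/-- The exponentially affine ansatz `V(t,y,v) = (y^γ/γ)·exp(a(t)+b(t)v)` solves the
nonlinear HJB PDE of the unconstrained power-utility problem under the Heston model. -/
theorem stmt_0
    (r κ θ lam σ ρ γ T : ℝ) (hγ1 : γ < 1) (hγ0 : γ ≠ 0)
    (k₀ k₁ k₂ : ℝ)
    (hk₀ : k₀ = γ * lam ^ 2 / (1 - γ))
    (hk₁ : k₁ = κ - γ * lam * σ * ρ / (1 - γ))
    (hk₂ : k₂ = σ ^ 2 + γ * σ ^ 2 * ρ ^ 2 / (1 - γ))
    (a b : ℝ → ℝ) (ha : Differentiable ℝ a) (hb : Differentiable ℝ b)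
    (hb' : ∀ t : ℝ, deriv b t = -((1 / 2) * k₂ * (b t) ^ 2 - k₁ * b t + (1 / 2) * k₀))
    (ha' : ∀ t : ℝ, deriv a t = -(κ * θ * b t + γ * r))
    (haT : a T = 0) (hbT : b T = 0)
    (V : ℝ → ℝ → ℝ → ℝ)
    (hV : ∀ t y v : ℝ, V t y v = y ^ γ / γ * Real.exp (a t + b t * v)) :
    (∀ y : ℝ, 0 < y → ∀ v : ℝ, V T y v = y ^ γ / γ) ∧
    (∀ t y : ℝ, 0 < y → ∀ v : ℝ,
      deriv (fun y' => deriv (fun y'' => V t y'' v) y') y ≠ 0 ∧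
      deriv (fun s => V s y v) t
        + κ * θ * deriv (fun w => V t y w) v
        + y * r * deriv (fun y' => V t y' v) y
        + v * ((1 / 2) * σ ^ 2 * deriv (fun w => deriv (fun w' => V t y w') w) v
            - κ * deriv (fun w => V t y w) v
            - (lam * deriv (fun y' => V t y' v) y
                + σ * ρ * deriv (fun w => deriv (fun y' => V t y' w) y) v) ^ 2
              / (2 * deriv (fun y' => deriv (fun y'' => V t y'' v) y') y)) = 0) := by
  refine ⟨fun y _ v => by simp [hV, haT, hbT], fun t y hy v => ?_⟩
  have hγ : 1 - γ ≠ 0 := by linarith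
  have hγ' : γ - 1 ≠ 0 := by linarith
  have hVy (w : ℝ) {x : ℝ} (hx : 0 < x) :
      deriv (fun x' => V t x' w) x = x ^ (γ - 1) * Real.exp (a t + b t * w) := by
    have hfun : (fun x' => V t x' w) =
        fun x' : ℝ => γ⁻¹ * x' ^ γ * Real.exp (a t + b t * w) := by
      funext x'
      rw [hV]
      ring
    rw [hfun, deriv_const_mul_rpow_mul_const _ _ _ hx, inv_mul_cancel₀ hγ0, one_mul]
  have hVyy : deriv (fun y' => deriv (fun y'' => V t y'' v) y') y =
      (γ - 1) * y ^ (γ - 1 - 1) * Real.exp (a t + b t * v) := by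
    have heq : (fun y' => deriv (fun y'' => V t y'' v) y') =ᶠ[nhds y]
        fun y' : ℝ => 1 * y' ^ (γ - 1) * Real.exp (a t + b t * v) := by
      filter_upwards [eventually_gt_nhds hy] with x hx
      rw [hVy v hx, one_mul]
    rw [heq.deriv_eq, deriv_const_mul_rpow_mul_const _ _ _ hy, one_mul]
  have hVv (w : ℝ) : deriv (fun w' => V t y w') w =
      y ^ γ / γ * b t * Real.exp (a t + b t * w) := by
    simp only [hV, deriv_const_mul_exp_affine]
  have hVvv : deriv (fun w => deriv (fun w' => V t y w') w) v =
      y ^ γ / γ * b t * b t * Real.exp (a t + b t * v) := by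
    simp only [hVv, deriv_const_mul_exp_affine]
  have hVyv : deriv (fun w => deriv (fun y' => V t y' w) y) v =
      y ^ (γ - 1) * b t * Real.exp (a t + b t * v) := by
    simp only [hVy _ hy, deriv_const_mul_exp_affine]
  have hVt : deriv (fun s => V s y v) t =
      y ^ γ / γ * (Real.exp (a t + b t * v) * (deriv a t + deriv b t * v)) := by
    simp only [hV]
    exact ((((ha t).hasDerivAt.add ((hb t).hasDerivAt.mul_const v)).exp).const_mul _).deriv
  have hE : Real.exp (a t + b t * v) ≠ 0 := (Real.exp_pos _).ne'
  have hP : y ^ γ ≠ 0 := (Real.rpow_pos_of_pos hy γ).ne'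
  rw [hVyy, hVt, hVvv, hVv, hVyv, hVy v hy, ha', hb', hk₀, hk₁, hk₂,
    Real.rpow_sub_one hy.ne' (γ - 1), Real.rpow_sub_one hy.ne' γ]
  have hy0 := hy.ne'
  generalize Real.exp (a t + b t * v) = E at *
  generalize y ^ γ = P at *
  refine ⟨by positivity, ?_⟩
  have hquot : (lam * (P / y * E) + σ * ρ * (P / y * b t * E)) ^ 2 /
      (2 * ((γ - 1) * (P / y / y) * E)) =
      -(P * E * (lam + σ * ρ * b t) ^ 2 / (2 * (1 - γ))) := by
    rw [← neg_sub 1 γ]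
    field_simp
  rw [hquot]
  field_simp
  ring
end

section
/- Let γ < 1 with γ ≠ 0 and let r, κ, θ, λ̄, σ, ρ be real numbers with ρ² ≤ 1. Set k₀ = γλ̄²/(1−γ), k₁ = κ − γλ̄σρ/(1−γ), k₂ = σ² + γσ²ρ²/(1−γ). Let a, b : ℝ → ℝ be differentiable with b'(t) = −(½k₂ b(t)² − k₁ b(t) + ½k₀) and a'(t) = −(κθ b(t) + γ r) for all t. Define π(t) = (λ̄ + σρ b(t))/(1−γ) and κ̃(t) = κ + σλ̄ρ − σ²(1−ρ²) b(t). Let g : ℝ × (0,∞) × ℝ → ℝ be twice continuously differentiable and satisfy, for all t ∈ ℝ, y > 0, v ∈ ℝ: ∂_t g − r g + y r ∂_y g + (κθ − κ̃(t) v) ∂_v g + ½ v y² π(t)² ∂_{yy} g + ½ v σ² ∂_{vv} g + ρ σ y v π(t) ∂_{yv} g = 0. Define G(t,y,v) = y^{γ−1}·exp(a(t) + b(t)·v)·g(t,y,v). Then for all t ∈ ℝ, y > 0, v ∈ ℝ: ∂_t G + y (r + π(t) λ̄ v) ∂_y G + κ(θ − v) ∂_v G + ½ v y² π(t)² ∂_{yy}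 G + ½ v σ² ∂_{vv} G + ρ σ y v π(t) ∂_{yv} G = 0. -/
/-- The partial derivative in the middle variable of a differentiable function of three variables is the
Fréchet derivative in the corresponding direction. -/
theorem deriv_middle_eq_fderiv {F : ℝ × ℝ × ℝ → ℝ} {t y v : ℝ}
    (hF : DifferentiableAt ℝ F (t, y, v)) :
    deriv (fun y' => F (t, y', v)) y = fderiv ℝ F (t, y, v) (0, 1, 0) := by
  have h : HasDerivAt (fun y' : ℝ => ((t, y', v) : ℝ × ℝ × ℝ)) (0, 1, 0) y :=
    (hasDerivAt_const y t).prodMk ((hasDerivAt_id y).prodMk (hasDerivAt_const y v))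
  exact (hF.hasFDerivAt.comp_hasDerivAt y h).deriv

/-- The partial derivative in the middle variable of a `C²` function of three variables is
differentiable in the last variable. -/
theorem differentiableAt_deriv_middle {F : ℝ × ℝ × ℝ → ℝ} {t y : ℝ}
    (hF : ∀ w, ContDiffAt ℝ 2 F (t, y, w)) (v : ℝ) :
    DifferentiableAt ℝ (fun w => deriv (fun y' => F (t, y', w)) y) v := by
  have h1 : (fun w => deriv (fun y' => F (t, y', w)) y)
      = fun w => fderiv ℝ F (t, y, w) (0, 1, 0) :=
    funext fun w => deriv_middle_eq_fderiv ((hF w).differentiableAt (by norm_num))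
  rw [h1]
  have h2 : DifferentiableAt ℝ (fderiv ℝ F) (t, y, v) :=
    ((hF v).fderiv_right (m := 1) (by norm_num)).differentiableAt (by norm_num)
  have h3 : DifferentiableAt ℝ (fun w : ℝ => ((t, y, w) : ℝ × ℝ × ℝ)) v := by fun_prop
  have h4 : DifferentiableAt ℝ (fun w => fderiv ℝ F (t, y, w)) v := h2.comp v h3
  exact h4.clm_apply (differentiableAt_const _)

/-- The derivative of a real function that is `C²` at a point is differentiable there. -/
theorem ContDiffAt.differentiableAt_deriv_of_two {f : ℝ → ℝ} {x : ℝ} (hf : ContDiffAt ℝ 2 f x) :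
    DifferentiableAt ℝ (deriv f) x := by
  have h : DifferentiableAt ℝ (fderiv ℝ f) x :=
    (hf.fderiv_right (m := 1) (by norm_num)).differentiableAt (by norm_num)
  exact h.clm_apply (differentiableAt_const 1)

/-- First derivative of a product with a real power. -/
theorem hasDerivAt_rpow_mul {f : ℝ → ℝ} {f' p c y : ℝ} (hy : 0 < y) (hf : HasDerivAt f f' y) :
    HasDerivAt (fun x => x ^ p * c * f x) (y ^ p * c * (p / y * f y + f')) y := by
  have h := ((Real.hasDerivAt_rpow_const (p := p) (Or.inl hy.ne')).mul_const c).mul hf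
  refine h.congr_deriv ?_
  rw [Real.rpow_sub_one hy.ne']
  ring

/-- First derivative of a product with the exponential of an affine function. -/
theorem hasDerivAt_exp_mul {f : ℝ → ℝ} {f' α β c v : ℝ} (hf : HasDerivAt f f' v) :
    HasDerivAt (fun w => c * Real.exp (α + β * w) * f w)
      (c * Real.exp (α + β * v) * (β * f v + f')) v := by
  have h := (((((hasDerivAt_id v).const_mul β).const_add α).exp).const_mul c).mul hf
  refine h.congr_deriv ?_
  simp only [id]
  ring


/-- The measure-change identity: if `g` solves the pricing (Feynman–Kac) PDE under the EMM
with `κ̃(t) = κ + σλ̄ρ − σ²(1−ρ²)b(t)`, then `G(t,y,v) = y^{γ−1}·exp(a(t)+b(t)v)·g(t,y,v)`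
solves the Feynman–Kac PDE of a real-world expectation. -/
theorem stmt_1
    (γ r κ θ lam σ ρ : ℝ) (hγ1 : γ < 1) (hγ0 : γ ≠ 0) (hρ : ρ ^ 2 ≤ 1)
    (k₀ k₁ k₂ : ℝ)
    (hk₀ : k₀ = γ * lam ^ 2 / (1 - γ))
    (hk₁ : k₁ = κ - γ * lam * σ * ρ / (1 - γ))
    (hk₂ : k₂ = σ ^ 2 + γ * σ ^ 2 * ρ ^ 2 / (1 - γ))
    (a b : ℝ → ℝ) (ha : Differentiable ℝ a) (hb : Differentiable ℝ b)
    (hb' : ∀ t : ℝ, deriv b t = -((1 / 2) * k₂ * (b t) ^ 2 - k₁ * b t + (1 / 2) * k₀))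
    (ha' : ∀ t : ℝ, deriv a t = -(κ * θ * b t + γ * r))
    (π κt : ℝ → ℝ)
    (hπ : ∀ t : ℝ, π t = (lam + σ * ρ * b t) / (1 - γ))
    (hκt : ∀ t : ℝ, κt t = κ + σ * lam * ρ - σ ^ 2 * (1 - ρ ^ 2) * b t)
    (g : ℝ → ℝ → ℝ → ℝ)
    (hg2 : ContDiffOn ℝ 2 (fun p : ℝ × ℝ × ℝ => g p.1 p.2.1 p.2.2)
      {p : ℝ × ℝ × ℝ | 0 < p.2.1})
    (hg : ∀ t y : ℝ, 0 < y → ∀ v : ℝ,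
      deriv (fun s => g s y v) t - r * g t y v + y * r * deriv (fun y' => g t y' v) y
        + (κ * θ - κt t * v) * deriv (fun w => g t y w) v
        + (1 / 2) * v * y ^ 2 * (π t) ^ 2 * deriv (fun y' => deriv (fun y'' => g t y'' v) y') y
        + (1 / 2) * v * σ ^ 2 * deriv (fun w => deriv (fun w' => g t y w') w) v
        + ρ * σ * y * v * π t * deriv (fun w => deriv (fun y' => g t y' w) y) v = 0)
    (G : ℝ → ℝ → ℝ → ℝ)
    (hG : ∀ t y v : ℝ, G t y v = y ^ (γ - 1) * Real.exp (a t + b t * v) * g t y v) :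
    ∀ t y : ℝ, 0 < y → ∀ v : ℝ,
      deriv (fun s => G s y v) t + y * (r + π t * lam * v) * deriv (fun y' => G t y' v) y
        + κ * (θ - v) * deriv (fun w => G t y w) v
        + (1 / 2) * v * y ^ 2 * (π t) ^ 2 * deriv (fun y' => deriv (fun y'' => G t y'' v) y') y
        + (1 / 2) * v * σ ^ 2 * deriv (fun w => deriv (fun w' => G t y w') w) v
        + ρ * σ * y * v * π t * deriv (fun w => deriv (fun y' => G t y' w) y) v = 0 := by
  intro t y hy v
  obtain rfl : G = fun t y v => y ^ (γ - 1) * Real.exp (a t + b t * v) * g t y v := by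
    funext t y v; exact hG t y v
  have hopen : IsOpen {p : ℝ × ℝ × ℝ | 0 < p.2.1} :=
    isOpen_lt continuous_const (by fun_prop)
  have hC : ∀ y, 0 < y → ∀ w, ContDiffAt ℝ 2 (fun p : ℝ × ℝ × ℝ => g p.1 p.2.1 p.2.2) (t, y, w) :=
    fun y hy w => hg2.contDiffAt (hopen.mem_nhds hy)
  have hCt : ContDiffAt ℝ 2 (fun s => g s y v) t :=
    (hC y hy v).comp t (f := fun s : ℝ => ((s, y, v) : ℝ × ℝ × ℝ)) (by fun_prop)
  have hCy : ∀ y, 0 < y → ∀ w, ContDiffAt ℝ 2 (fun y' => g t y' w) y := fun y hy w =>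
    (hC y hy w).comp y (f := fun y' : ℝ => ((t, y', w) : ℝ × ℝ × ℝ)) (by fun_prop)
  have hCv : ∀ w, ContDiffAt ℝ 2 (fun w' => g t y w') w := fun w =>
    (hC y hy w).comp w (f := fun w' : ℝ => ((t, y, w') : ℝ × ℝ × ℝ)) (by fun_prop)
  have dt := (hCt.differentiableAt (by norm_num)).hasDerivAt
  have dy := fun y hy w => ((hCy y hy w).differentiableAt (by norm_num)).hasDerivAt
  have dv := fun w => ((hCv w).differentiableAt (by norm_num)).hasDerivAt
  have dyy := (hCy y hy v).differentiableAt_deriv_of_two.hasDerivAt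
  have dvv := (hCv v).differentiableAt_deriv_of_two.hasDerivAt
  have dyv := (differentiableAt_deriv_middle (hC y hy) v).hasDerivAt
  have Gt : deriv (fun s => y ^ (γ - 1) * Real.exp (a s + b s * v) * g s y v) t
      = y ^ (γ - 1) * Real.exp (a t + b t * v)
        * ((deriv a t + deriv b t * v) * g t y v + deriv (fun s => g s y v) t) := by
    have h := ((((ha t).hasDerivAt.add ((hb t).hasDerivAt.mul_const v)).exp).const_mul
      (y ^ (γ - 1))).mul dt
    refine (h.congr_deriv ?_).deriv
    simp only [Pi.add_apply]
    ring
  have Gy : ∀ y, 0 < y → ∀ w,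
      deriv (fun y' => y' ^ (γ - 1) * Real.exp (a t + b t * w) * g t y' w) y
      = y ^ (γ - 1) * Real.exp (a t + b t * w)
        * ((γ - 1) / y * g t y w + deriv (fun y' => g t y' w) y) := fun y hy w =>
    (hasDerivAt_rpow_mul hy (dy y hy w)).deriv
  have Gv : ∀ w, deriv (fun w' => y ^ (γ - 1) * Real.exp (a t + b t * w') * g t y w') w
      = y ^ (γ - 1) * Real.exp (a t + b t * w)
        * (b t * g t y w + deriv (fun w' => g t y w') w) := fun w =>
    (hasDerivAt_exp_mul (dv w)).deriv
  have Gyy : deriv (fun y' => deriv (fun y'' =>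
        y'' ^ (γ - 1) * Real.exp (a t + b t * v) * g t y'' v) y') y
      = y ^ (γ - 1) * Real.exp (a t + b t * v)
        * ((γ - 1) * (γ - 2) / y ^ 2 * g t y v
          + 2 * (γ - 1) / y * deriv (fun y' => g t y' v) y
          + deriv (fun y' => deriv (fun y'' => g t y'' v) y') y) := by
    have he : (fun y' => deriv (fun y'' =>
        y'' ^ (γ - 1) * Real.exp (a t + b t * v) * g t y'' v) y') =ᶠ[nhds y]
        fun y' => y' ^ (γ - 1) * Real.exp (a t + b t * v)
          * ((γ - 1) * y'⁻¹ * g t y' v + deriv (fun y'' => g t y'' v) y') := by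
      filter_upwards [lt_mem_nhds hy] with y' hy'
      rw [Gy y' hy' v, div_eq_mul_inv]
    rw [he.deriv_eq]
    have h := hasDerivAt_rpow_mul (p := γ - 1) (c := Real.exp (a t + b t * v)) hy
      ((((hasDerivAt_inv hy.ne').const_mul (γ - 1)).mul (dy y hy v)).add dyy)
    refine (h.congr_deriv ?_).deriv
    simp only [Pi.add_apply, Pi.mul_apply]
    field_simp
    ring
  have Gvv : deriv (fun w => deriv (fun w' =>
        y ^ (γ - 1) * Real.exp (a t + b t * w') * g t y w') w) v
      = y ^ (γ - 1) * Real.exp (a t + b t * v)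
        * (b t ^ 2 * g t y v + 2 * b t * deriv (fun w => g t y w) v
          + deriv (fun w => deriv (fun w' => g t y w') w) v) := by
    rw [funext Gv]
    have h := hasDerivAt_exp_mul (α := a t) (β := b t) (c := y ^ (γ - 1))
      (((dv v).const_mul (b t)).add dvv)
    refine (h.congr_deriv ?_).deriv
    simp only [Pi.add_apply]
    ring
  have Gyv : deriv (fun w => deriv (fun y' =>
        y' ^ (γ - 1) * Real.exp (a t + b t * w) * g t y' w) y) v
      = y ^ (γ - 1) * Real.exp (a t + b t * v)
        * ((γ - 1) / y * b t * g t y v + (γ - 1) / y * deriv (fun w => g t y w) v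
          + b t * deriv (fun y' => g t y' v) y
          + deriv (fun w => deriv (fun y' => g t y' w) y) v) := by
    rw [funext (Gy y hy)]
    have h := hasDerivAt_exp_mul (α := a t) (β := b t) (c := y ^ (γ - 1))
      (((dv v).const_mul ((γ - 1) / y)).add dyv)
    refine (h.congr_deriv ?_).deriv
    simp only [Pi.add_apply]
    ring
  have hpde := hg t y hy v
  beta_reduce
  rw [Gt, Gy y hy v, Gv v, Gyy, Gvv, Gyv, ha' t, hb' t]
  rw [hκt t] at hpde
  have h1γ : 1 - γ ≠ 0 := by linarith
  rw [hπ t] at hpde ⊢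
  subst hk₀ hk₁ hk₂
  generalize deriv (fun s => g s y v) t = gt at *
  generalize deriv (fun w => deriv (fun y' => g t y' w) y) v = gyv at *
  generalize deriv (fun y' => deriv (fun y'' => g t y'' v) y') y = gyy at *
  generalize deriv (fun w => deriv (fun w' => g t y w') w) v = gvv at *
  generalize deriv (fun y' => g t y' v) y = gy at *
  generalize deriv (fun w => g t y w) v = gv at *
  generalize y ^ (γ - 1) * Real.exp (a t + b t * v) = M at *
  generalize g t y v = g₀ at *
  generalize b t = β at *
  rw [← mul_zero M, ← hpde]
  field_simp
  ring
end

section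
/- Let r, κ, θ, λ̄, σ, ρ, T, u be real numbers and let π : ℝ → ℝ be any function. Let A, B : ℝ → ℂ be differentiable and satisfy, for all τ ∈ ℝ: B'(τ) = (π(T−τ) σ ρ i u − κ) B(τ) + ½σ² B(τ)² − ½π(T−τ)² (u² + i u) + π(T−τ) λ̄ i u, and A'(τ) = r i u + κθ B(τ), with A(0) = 0 and B(0) = 0. Define φ : ℝ³ → ℂ by φ(t,z,v) = exp(A(T−t) + B(T−t)·v + i u z). Then φ(T,z,v) = exp(i u z) for all z, v, and for all t, z, v ∈ ℝ: ∂_t φ + (r + (π(t) λ̄ − ½π(t)²) v) ∂_z φ + κ(θ − v) ∂_v φ + ½ π(t)² v ∂_{zz} φ + π(t) v σ ρ ∂_{zv} φ + ½ σ² v ∂_{vv} φ = 0. -/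
/-- The derivative of `c * exp (a + b * x)` along the real line. -/
theorem hasDerivAt_const_mul_cexp_affine (c a b : ℂ) (x : ℝ) :
    HasDerivAt (fun y : ℝ => c * Complex.exp (a + b * (y : ℂ)))
      (c * b * Complex.exp (a + b * (x : ℂ))) x := by
  have h : HasDerivAt (fun y : ℝ => a + b * (y : ℂ)) (b * 1) x :=
    ((Complex.ofRealCLM.hasDerivAt (x := x)).const_mul b).const_add a
  exact (h.cexp.const_mul c).congr_deriv (by ring)

open Complex in
/-- The exponentially affine ansatz for the characteristic function of the log-wealth
under the real-world measure solves the Feynman–Kac PDE. -/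
theorem stmt_2
    (r κ θ lam σ ρ T u : ℝ) (π : ℝ → ℝ)
    (A B : ℝ → ℂ) (hA : Differentiable ℝ A) (hB : Differentiable ℝ B)
    (hB' : ∀ τ : ℝ, deriv B τ =
      (((π (T - τ) * σ * ρ * u : ℝ) : ℂ) * Complex.I - ((κ : ℝ) : ℂ)) * B τ
        + (1 / 2 : ℂ) * ((σ : ℝ) : ℂ) ^ 2 * (B τ) ^ 2
        - (1 / 2 : ℂ) * (((π (T - τ)) ^ 2 : ℝ) : ℂ) * (((u ^ 2 : ℝ) : ℂ) + ((u : ℝ) : ℂ) * Complex.I)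
        + ((π (T - τ) * lam * u : ℝ) : ℂ) * Complex.I)
    (hA' : ∀ τ : ℝ, deriv A τ = ((r * u : ℝ) : ℂ) * Complex.I + ((κ * θ : ℝ) : ℂ) * B τ)
    (hA0 : A 0 = 0) (hB0 : B 0 = 0)
    (φ : ℝ → ℝ → ℝ → ℂ)
    (hφ : ∀ t z v : ℝ, φ t z v =
      Complex.exp (A (T - t) + B (T - t) * ((v : ℝ) : ℂ) + Complex.I * ((u : ℝ) : ℂ) * ((z : ℝ) : ℂ))) :
    (∀ z v : ℝ, φ T z v = Complex.exp (Complex.I * ((u : ℝ) : ℂ) * ((z : ℝ) : ℂ))) ∧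
    (∀ t z v : ℝ,
      deriv (fun s => φ s z v) t
        + ((r + (π t * lam - (1 / 2) * (π t) ^ 2) * v : ℝ) : ℂ) * deriv (fun z' => φ t z' v) z
        + ((κ * (θ - v) : ℝ) : ℂ) * deriv (fun w => φ t z w) v
        + (((1 / 2) * (π t) ^ 2 * v : ℝ) : ℂ) * deriv (fun z' => deriv (fun z'' => φ t z'' v) z') z
        + ((π t * v * σ * ρ : ℝ) : ℂ) * deriv (fun w => deriv (fun z' => φ t z' w) z) v
        + (((1 / 2) * σ ^ 2 * v : ℝ) : ℂ) * deriv (fun w => deriv (fun w' => φ t z w') w) v = 0) := by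
  refine ⟨fun z v => by simp [hφ, hA0, hB0], fun t z v => ?_⟩
  have hz (c : ℂ) (t z v : ℝ) :
      HasDerivAt (fun z' => c * φ t z' v) (c * (Complex.I * u) * φ t z v) z := by
    have h := hasDerivAt_const_mul_cexp_affine c (A (T - t) + B (T - t) * v) (Complex.I * u) z
    simpa only [hφ] using h
  have hv (c : ℂ) (t z v : ℝ) :
      HasDerivAt (fun w => c * φ t z w) (c * B (T - t) * φ t z v) v := by
    have h := hasDerivAt_const_mul_cexp_affine c (A (T - t) + Complex.I * u * z) (B (T - t)) v
    simpa only [hφ, add_right_comm] using h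
  have ht : HasDerivAt (fun s => φ s z v)
      (-(deriv A (T - t) + deriv B (T - t) * v) * φ t z v) t := by
    have hA1 := (hA (T - t)).hasDerivAt.comp_const_sub T t
    have hB1 := (hB (T - t)).hasDerivAt.comp_const_sub T t
    have h := ((hA1.fun_add (hB1.mul_const (v : ℂ))).add_const (Complex.I * u * z)).cexp
    simp only [hφ]
    exact h.congr_deriv (by ring)
  have hz1 (t z v : ℝ) : deriv (fun z' => φ t z' v) z = Complex.I * u * φ t z v := by
    simpa only [one_mul] using (hz 1 t z v).deriv
  have hv1 (t z v : ℝ) : deriv (fun w => φ t z w) v = B (T - t) * φ t z v := by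
    simpa only [one_mul] using (hv 1 t z v).deriv
  simp only [hz1, hv1]
  rw [ht.deriv, (hz _ t z v).deriv, (hv (Complex.I * u) t z v).deriv,
    (hv (B (T - t)) t z v).deriv, hA', hB', sub_sub_cancel]
  push_cast
  linear_combination (1 / 2 * (π t : ℂ) ^ 2 * v * u ^ 2 * φ t z v) * Complex.I_sq
end

section
/- Let r, σ, ρ, T, u be real numbers, let π, κ̃, θ̃ : ℝ → ℝ be functions, and let A, B : ℝ → ℂ be differentiable and satisfy, for all τ ∈ ℝ: B'(τ) = (π(T−τ) σ ρ i u − κ̃(T−τ)) B(τ) + ½σ² B(τ)² − ½π(T−τ)² (u² + i u), and A'(τ) = r i u + κ̃(T−τ) θ̃(T−τ) B(τ), with A(0) = 0 and B(0) = 0. Define φ : ℝ³ → ℂ by φ(t,z,v) = exp(A(T−t) + B(T−t)·v + i u z). Then φ(T,z,v) = exp(i u z) for all z, v, and for all t, z, v ∈ ℝ: ∂_t φ + (r − ½π(t)² v) ∂_z φ + κ̃(t)(θ̃(t) − v) ∂_v φ + ½ π(t)² v ∂_{zz} φ + π(t) v σ ρ ∂_{zv} φ + ½ σ² v ∂_{vv}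 φ = 0. -/
/-- The exponentially affine ansatz for the characteristic function of the log-wealth
under an equivalent martingale measure (with possibly time-dependent risk-neutral
mean-reversion rate `κ̃(t)` and long-run mean `θ̃(t)`) solves the Feynman–Kac PDE. -/
theorem stmt_3
    (r σ ρ T u : ℝ) (π κt θt : ℝ → ℝ)
    (A B : ℝ → ℂ) (hA : Differentiable ℝ A) (hB : Differentiable ℝ B)
    (hB' : ∀ τ : ℝ, deriv B τ =
      (((π (T - τ) * σ * ρ * u : ℝ) : ℂ) * Complex.I - ((κt (T - τ) : ℝ) : ℂ)) * B τ
        + (1 / 2 : ℂ) * ((σ : ℝ) : ℂ) ^ 2 * (B τ) ^ 2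
        - (1 / 2 : ℂ) * (((π (T - τ)) ^ 2 : ℝ) : ℂ) * (((u ^ 2 : ℝ) : ℂ) + ((u : ℝ) : ℂ) * Complex.I))
    (hA' : ∀ τ : ℝ, deriv A τ =
      ((r * u : ℝ) : ℂ) * Complex.I + ((κt (T - τ) * θt (T - τ) : ℝ) : ℂ) * B τ)
    (hA0 : A 0 = 0) (hB0 : B 0 = 0)
    (φ : ℝ → ℝ → ℝ → ℂ)
    (hφ : ∀ t z v : ℝ, φ t z v =
      Complex.exp (A (T - t) + B (T - t) * ((v : ℝ) : ℂ) + Complex.I * ((u : ℝ) : ℂ) * ((z : ℝ) : ℂ))) :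
    (∀ z v : ℝ, φ T z v = Complex.exp (Complex.I * ((u : ℝ) : ℂ) * ((z : ℝ) : ℂ))) ∧
    (∀ t z v : ℝ,
      deriv (fun s => φ s z v) t
        + ((r - (1 / 2) * (π t) ^ 2 * v : ℝ) : ℂ) * deriv (fun z' => φ t z' v) z
        + ((κt t * (θt t - v) : ℝ) : ℂ) * deriv (fun w => φ t z w) v
        + (((1 / 2) * (π t) ^ 2 * v : ℝ) : ℂ) * deriv (fun z' => deriv (fun z'' => φ t z'' v) z') z
        + ((π t * v * σ * ρ : ℝ) : ℂ) * deriv (fun w => deriv (fun z' => φ t z' w) z) v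
        + (((1 / 2) * σ ^ 2 * v : ℝ) : ℂ) * deriv (fun w => deriv (fun w' => φ t z w') w) v = 0) := by
  have hz : ∀ t z v : ℝ, HasDerivAt (fun z' => φ t z' v) (Complex.I * u * φ t z v) z := by
    intro t z v
    simp only [hφ]
    have h := (((Complex.ofRealCLM.hasDerivAt (x := z)).const_mul (Complex.I * (u : ℂ))).const_add
      (A (T - t) + B (T - t) * (v : ℂ))).cexp
    refine h.congr_deriv ?_
    simp only [Complex.ofRealCLM_apply, Complex.ofReal_one]
    ring
  have hv : ∀ t z v : ℝ, HasDerivAt (fun w => φ t z w) (B (T - t) * φ t z v) v := by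
    intro t z v
    simp only [hφ]
    have h := ((((Complex.ofRealCLM.hasDerivAt (x := v)).const_mul (B (T - t))).const_add
      (A (T - t))).add_const (Complex.I * (u : ℂ) * (z : ℂ))).cexp
    refine h.congr_deriv ?_
    simp only [Complex.ofRealCLM_apply, Complex.ofReal_one]
    ring
  have ht : ∀ t z v : ℝ, HasDerivAt (fun s => φ s z v)
      (-(deriv A (T - t) + deriv B (T - t) * v) * φ t z v) t := by
    intro t z v
    simp only [hφ]
    have h := ((((hA (T - t)).hasDerivAt.comp_const_sub T t).add
      (((hB (T - t)).hasDerivAt.comp_const_sub T t).mul_const (v : ℂ))).add_const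
        (Complex.I * (u : ℂ) * (z : ℂ))).cexp
    refine h.congr_deriv ?_
    simp only [Pi.add_apply]
    ring
  refine ⟨fun z v => by simp [hφ, hA0, hB0], fun t z v => ?_⟩
  simp only [(hz _ _ _).deriv, (hv _ _ _).deriv, (ht _ _ _).deriv,
    ((hz _ _ _).const_mul _).deriv, ((hv _ _ _).const_mul _).deriv, hA', hB', sub_sub_cancel]
  push_cast
  linear_combination (1 / 2 * (π t : ℂ) ^ 2 * v * u ^ 2 * φ t z v) * Complex.I_sq
end

section
/- Let k₀, k₁, k₂ be real numbers with k₁ > 0 and k₁² − k₀·k₂ > 0, and set k₃ = √(k₁² − k₀·k₂). Define b : ℝ → ℝ by b(τ) = k₀·(exp(k₃τ) − 1)/(exp(k₃τ)·(k₁ + k₃) − k₁ + k₃). Then for every τ ≥ 0 the denominator exp(k₃τ)·(k₁ + k₃) − k₁ + k₃ is strictly positive, b(0) = 0, and for every τ ≥ 0 the function b is differentiable at τ with b'(τ) = ½·k₂·b(τ)² − k₁·b(τ) + ½·k₀. -/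
/-- Verification of the explicit solution of the Riccati ODE
`b'(τ) = ½k₂b² − k₁b + ½k₀`, `b(0) = 0`. -/
theorem stmt_10
    (k₀ k₁ k₂ : ℝ) (hk₁ : 0 < k₁) (hdisc : 0 < k₁ ^ 2 - k₀ * k₂)
    (k₃ : ℝ) (hk₃ : k₃ = Real.sqrt (k₁ ^ 2 - k₀ * k₂))
    (b : ℝ → ℝ)
    (hb : ∀ τ : ℝ, b τ =
      k₀ * (Real.exp (k₃ * τ) - 1) / (Real.exp (k₃ * τ) * (k₁ + k₃) - k₁ + k₃)) :
    (∀ τ : ℝ, 0 ≤ τ → 0 < Real.exp (k₃ * τ) * (k₁ + k₃) - k₁ + k₃) ∧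
    b 0 = 0 ∧
    (∀ τ : ℝ, 0 ≤ τ →
      HasDerivAt b ((1 / 2) * k₂ * (b τ) ^ 2 - k₁ * b τ + (1 / 2) * k₀) τ) := by
  have hk₃_pos : 0 < k₃ := hk₃ ▸ Real.sqrt_pos.mpr hdisc
  have hk₃_sq : k₃ ^ 2 = k₁ ^ 2 - k₀ * k₂ := hk₃ ▸ Real.sq_sqrt hdisc.le
  have hden : ∀ τ : ℝ, 0 ≤ τ → 0 < Real.exp (k₃ * τ) * (k₁ + k₃) - k₁ + k₃ := by
    intro τ hτ
    have hexp : 1 ≤ Real.exp (k₃ * τ) := Real.one_le_exp (by positivity)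
    nlinarith
  refine ⟨hden, by simp [hb], fun τ hτ => ?_⟩
  have hD := (hden τ hτ).ne'
  have hE : HasDerivAt (fun t => Real.exp (k₃ * t)) (Real.exp (k₃ * τ) * k₃) τ := by
    simpa using ((hasDerivAt_id τ).const_mul k₃).exp
  have hquot := ((hE.sub_const 1).const_mul k₀).div
    (((hE.mul_const (k₁ + k₃)).sub_const k₁).add_const k₃) hD
  rw [funext hb]
  refine hquot.congr_deriv ?_
  beta_reduce
  generalize Real.exp (k₃ * τ) = E at hD ⊢
  field_simp
  linear_combination -k₀ * (E - 1) ^ 2 * hk₃_sq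
end

section
/- Let k₀, k₁, k₂, κ, θ, γ, r be real numbers with k₁ > 0, k₂ ≠ 0 and k₁² − k₀·k₂ > 0, and set k₃ = √(k₁² − k₀·k₂). Define b(τ) = k₀·(exp(k₃τ) − 1)/(exp(k₃τ)·(k₁ + k₃) − k₁ + k₃) and a(τ) = γrτ + (2θκ/k₂)·ln( 2k₃·exp(½(k₁+k₃)τ) / (2k₃ + (k₁+k₃)(exp(k₃τ) − 1)) ). Then for every τ ≥ 0 the quantity 2k₃ + (k₁+k₃)(exp(k₃τ) − 1) is strictly positive, a(0) = 0, and for every τ ≥ 0 the function a is differentiable at τ with a'(τ) = κθ·b(τ) + γr. -/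
/-- Verification of the explicit solution of the linear ODE
`a'(τ) = κθ·b(τ) + γr`, `a(0) = 0`, where `b` is the explicit Riccati solution. -/
theorem stmt_11
    (k₀ k₁ k₂ κ θ γ r : ℝ) (hk₁ : 0 < k₁) (hk₂ : k₂ ≠ 0)
    (hdisc : 0 < k₁ ^ 2 - k₀ * k₂)
    (k₃ : ℝ) (hk₃ : k₃ = Real.sqrt (k₁ ^ 2 - k₀ * k₂))
    (b a : ℝ → ℝ)
    (hb : ∀ τ : ℝ, b τ =
      k₀ * (Real.exp (k₃ * τ) - 1) / (Real.exp (k₃ * τ) * (k₁ + k₃) - k₁ + k₃))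
    (ha : ∀ τ : ℝ, a τ = γ * r * τ + (2 * θ * κ / k₂) *
      Real.log (2 * k₃ * Real.exp ((1 / 2) * (k₁ + k₃) * τ) /
        (2 * k₃ + (k₁ + k₃) * (Real.exp (k₃ * τ) - 1)))) :
    (∀ τ : ℝ, 0 ≤ τ → 0 < 2 * k₃ + (k₁ + k₃) * (Real.exp (k₃ * τ) - 1)) ∧
    a 0 = 0 ∧
    (∀ τ : ℝ, 0 ≤ τ → HasDerivAt a (κ * θ * b τ + γ * r) τ) := by
  have hk₃pos : 0 < k₃ := hk₃ ▸ Real.sqrt_pos.mpr hdisc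
  have hsq : k₃ ^ 2 = k₁ ^ 2 - k₀ * k₂ := hk₃ ▸ Real.sq_sqrt hdisc.le
  have hpos : ∀ τ : ℝ, 0 ≤ τ → 0 < 2 * k₃ + (k₁ + k₃) * (Real.exp (k₃ * τ) - 1) := by
    intro τ hτ
    have hexp : 0 ≤ Real.exp (k₃ * τ) - 1 :=
      sub_nonneg.mpr (Real.one_le_exp (by positivity))
    positivity
  refine ⟨hpos, ?_, ?_⟩
  · rw [ha]
    simp [hk₃pos.ne']
  · intro τ hτ
    have hD := hpos τ hτ
    have hlin : ∀ c : ℝ, HasDerivAt (fun t : ℝ => c * t) c τ := fun c => by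
      simpa using (hasDerivAt_id τ).const_mul c
    have hnum := ((hlin ((1 / 2) * (k₁ + k₃))).exp).const_mul (2 * k₃)
    have hden := ((((hlin k₃).exp).sub_const 1).const_mul (k₁ + k₃)).const_add (2 * k₃)
    have hlog := (hnum.fun_div hden hD.ne').log (by positivity)
    have hmain := (hlin (γ * r)).fun_add (hlog.const_mul (2 * θ * κ / k₂))
    rw [funext ha]
    refine hmain.congr_deriv ?_
    have hden_eq : Real.exp (k₃ * τ) * (k₁ + k₃) - k₁ + k₃ =
        2 * k₃ + (k₁ + k₃) * (Real.exp (k₃ * τ) - 1) := by ring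
    rw [hb, hden_eq]
    have hE := (Real.exp_pos ((1 / 2) * (k₁ + k₃) * τ)).ne'
    generalize Real.exp ((1 / 2) * (k₁ + k₃) * τ) = F at hE ⊢
    generalize Real.exp (k₃ * τ) = E at hD ⊢
    have hk₀ : k₀ = (k₁ ^ 2 - k₃ ^ 2) / k₂ := by
      rw [hsq]
      field_simp
      ring
    rw [hk₀]
    have hD' := hD.ne'
    field_simp
    ring
end

section
/- Let k_v, k_ε, K be real numbers with k_v ≤ k_ε ≤ K and k_v < K, and define D : ℝ → ℝ by D(y) = y + (K − y)·1_{{k_ε ≤ y ≤ K}}(y) − (y − k_v)·1_{{k_v ≤ y < k_ε}}(y). Then {y ∈ ℝ : D(y) < K} = {y ∈ ℝ : y < k_ε}. -/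
/-- Sublevel-set identity for the synthetic claim payoff:
`{D < K} = {y < k_ε}`. -/
theorem stmt_14
    (kv ke K : ℝ) (h1 : kv ≤ ke) (h2 : ke ≤ K) (h3 : kv < K)
    (D : ℝ → ℝ)
    (hD : ∀ y : ℝ, D y = y
      + (K - y) * Set.indicator {z : ℝ | ke ≤ z ∧ z ≤ K} (1 : ℝ → ℝ) y
      - (y - kv) * Set.indicator {z : ℝ | kv ≤ z ∧ z < ke} (1 : ℝ → ℝ) y) :
    {y : ℝ | D y < K} = {y : ℝ | y < ke} := by
  ext y
  simp only [Set.mem_ofPred_eq, hD, Set.indicator_apply, Pi.one_apply]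
  split_ifs <;> grind
end

section
/- Let α > 0 and let f : ℝ → ℝ be a measurable function with f ≥ 0, such that f is integrable on ℝ and the function z ↦ exp(−αz)·f(z) is integrable on ℝ. Then for every u ∈ ℝ, the complex-valued function k ↦ exp((iu − α)·k)·(∫_{(−∞,k]} f(z) dz) is integrable on ℝ, and ∫_ℝ exp((iu − α)·k)·(∫_{(−∞,k]} f(z) dz) dk = (1/(α − iu))·∫_ℝ exp((iu − α)·z)·f(z) dz. -/
open MeasureTheory

/-- The integrand of the double integral, seen as a function of the inner or the outer variable. -/
lemma exp_mul_indicator_Iic (a : ℂ) (f : ℝ → ℂ) (k z : ℝ) :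
    Complex.exp (a * k) * (Set.Iic k).indicator f z =
      (Set.Ici z).indicator (fun x : ℝ => Complex.exp (a * x)) k * f z := by
  by_cases h : z ≤ k <;> simp [Set.indicator, h]

lemma integrable_exp_mul_indicator_Iic {a : ℂ} (ha : a.re < 0) {f : ℝ → ℂ}
    (hfm : AEStronglyMeasurable f) (hf : Integrable fun z : ℝ => Complex.exp (a * z) * f z) :
    Integrable (Function.uncurry fun k z : ℝ =>
      Complex.exp (a * k) * (Set.Iic k).indicator f z) (volume.prod volume) := by
  have hmeas : AEStronglyMeasurable (Function.uncurry fun k z : ℝ =>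
      Complex.exp (a * k) * (Set.Iic k).indicator f z) (volume.prod volume) := by
    have hexp : Continuous fun p : ℝ × ℝ => Complex.exp (a * p.1) := by fun_prop
    exact hexp.aestronglyMeasurable.mul
      (hfm.comp_snd.indicator (measurableSet_le measurable_snd measurable_fst))
  refine (integrable_prod_iff' hmeas).2 ⟨.of_forall fun z => ?_, ?_⟩
  · simp only [Function.uncurry_apply_pair, exp_mul_indicator_Iic]
    exact (((integrableOn_Ici_iff_integrableOn_Ioi).2
      (integrableOn_exp_mul_complex_Ioi ha z)).integrable_indicator measurableSet_Ici).mul_const _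
  · convert! hf.norm.const_mul (-a.re)⁻¹ using 2 with z
    simp only [Function.uncurry_apply_pair, exp_mul_indicator_Iic, norm_mul,
      norm_indicator_eq_indicator_norm, integral_mul_const, integral_indicator measurableSet_Ici,
      integral_Ici_eq_integral_Ioi, Complex.norm_exp, Complex.re_mul_ofReal]
    rw [integral_exp_mul_Ioi ha]
    field_simp

lemma integral_exp_mul_indicator_Iic (a : ℂ) (f : ℝ → ℂ) (k : ℝ) :
    ∫ z, Complex.exp (a * k) * (Set.Iic k).indicator f z =
      Complex.exp (a * k) * ∫ z in Set.Iic k, f z := by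
  rw [integral_const_mul, integral_indicator measurableSet_Iic]

lemma integrable_exp_mul_setIntegral_Iic {a : ℂ} (ha : a.re < 0) {f : ℝ → ℂ}
    (hfm : AEStronglyMeasurable f) (hf : Integrable fun z : ℝ => Complex.exp (a * z) * f z) :
    Integrable fun k : ℝ => Complex.exp (a * k) * ∫ z in Set.Iic k, f z := by
  simpa only [Function.uncurry_apply_pair, integral_exp_mul_indicator_Iic] using
    (integrable_exp_mul_indicator_Iic ha hfm hf).integral_prod_left

lemma integral_exp_mul_setIntegral_Iic {a : ℂ} (ha : a.re < 0) {f : ℝ → ℂ}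
    (hfm : AEStronglyMeasurable f) (hf : Integrable fun z : ℝ => Complex.exp (a * z) * f z) :
    ∫ k : ℝ, Complex.exp (a * k) * ∫ z in Set.Iic k, f z =
      (1 / -a) * ∫ z : ℝ, Complex.exp (a * z) * f z := by
  simp_rw [← integral_exp_mul_indicator_Iic]
  rw [integral_integral_swap (integrable_exp_mul_indicator_Iic ha hfm hf), ← integral_const_mul]
  congr 1 with z
  simp only [exp_mul_indicator_Iic, integral_mul_const, integral_indicator measurableSet_Ici,
    integral_Ici_eq_integral_Ioi]
  rw [integral_exp_mul_complex_Ioi ha]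
  ring

/-- Fubini computation underlying the Carr–Madan formula for the price of a digital put:
the Fourier transform of the dampened cumulative distribution function equals
`1/(α − iu)` times the (dampened) characteristic function. -/
theorem stmt_17
    (α : ℝ) (hα : 0 < α) (f : ℝ → ℝ) (hfm : Measurable f) (hf0 : ∀ z : ℝ, 0 ≤ f z)
    (hfi : Integrable f)
    (hfe : Integrable (fun z : ℝ => Real.exp (-α * z) * f z)) :
    ∀ u : ℝ,
      Integrable (fun k : ℝ =>
        Complex.exp (((u : ℂ) * Complex.I - (α : ℂ)) * (k : ℂ)) *
          (((∫ z in Set.Iic k, f z) : ℝ) : ℂ)) ∧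
      (∫ k : ℝ, Complex.exp (((u : ℂ) * Complex.I - (α : ℂ)) * (k : ℂ)) *
          (((∫ z in Set.Iic k, f z) : ℝ) : ℂ))
        = (1 / ((α : ℂ) - (u : ℂ) * Complex.I)) *
            ∫ z : ℝ, Complex.exp (((u : ℂ) * Complex.I - (α : ℂ)) * (z : ℂ)) * ((f z : ℝ) : ℂ) := by
  intro u
  have ha : ((u : ℂ) * Complex.I - (α : ℂ)).re < 0 := by simpa using hα
  have hm : AEStronglyMeasurable fun z : ℝ => (f z : ℂ) :=
    (Complex.measurable_ofReal.comp hfm).aestronglyMeasurable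
  have he : Integrable fun z : ℝ =>
      Complex.exp (((u : ℂ) * Complex.I - (α : ℂ)) * (z : ℂ)) * (f z : ℂ) := by
    have hexp : Continuous fun z : ℝ =>
        Complex.exp (((u : ℂ) * Complex.I - (α : ℂ)) * (z : ℂ)) := by fun_prop
    refine hfe.mono (hexp.aestronglyMeasurable.mul hm) (.of_forall fun z => ?_)
    simp [Complex.norm_exp]
  simp only [← integral_complex_ofReal]
  refine ⟨integrable_exp_mul_setIntegral_Iic ha hm he, ?_⟩
  rw [integral_exp_mul_setIntegral_Iic ha hm he, neg_sub]
end

section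
/- Let α > 1 and let f : ℝ → ℝ be a measurable function with f ≥ 0, such that the function z ↦ exp((1 − α)·z)·f(z) is integrable on ℝ. Then for every u ∈ ℝ, the complex-valued function k ↦ exp((iu − α)·k)·(∫_ℝ max(exp(k) − exp(z), 0)·f(z) dz) is integrable on ℝ, and ∫_ℝ exp((iu − α)·k)·(∫_ℝ max(exp(k) − exp(z), 0)·f(z) dz) dk = (1/((α − iu)·(α − 1 − iu)))·∫_ℝ exp((iu − α + 1)·z)·f(z) dz, where (α − iu)·(α − 1 − iu) = α² − α − u² + iu·(1 − 2α). -/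
open MeasureTheory

/-- The damped call payoff, as a function of the log-strike `k`, vanishes for `k ≤ z` and is a
difference of exponentials for `k > z`. -/
lemma cexp_mul_max_exp_sub_exp_eq_indicator (a : ℂ) (z : ℝ) :
    (fun k : ℝ => Complex.exp (a * k) * ((max (Real.exp k - Real.exp z) 0 : ℝ) : ℂ)) =
      (Set.Ioi z).indicator
        (fun k : ℝ => Complex.exp ((a + 1) * k) - Complex.exp z * Complex.exp (a * k)) := by
  ext k
  by_cases hk : z < k
  · have hexp : Real.exp z < Real.exp k := Real.exp_lt_exp.mpr hk
    rw [Set.indicator_of_mem (Set.mem_Ioi.mpr hk), max_eq_left (by linarith)]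
    push_cast
    rw [add_mul, one_mul, Complex.exp_add]
    ring
  · have hexp : Real.exp k ≤ Real.exp z := Real.exp_le_exp.mpr (not_lt.mp hk)
    rw [Set.indicator_of_notMem (by simpa using hk), max_eq_right (by linarith)]
    simp

lemma integrable_cexp_mul_max_exp_sub_exp {a : ℂ} (ha : a.re < -1) (z : ℝ) :
    Integrable (fun k : ℝ =>
      Complex.exp (a * k) * ((max (Real.exp k - Real.exp z) 0 : ℝ) : ℂ)) := by
  rw [cexp_mul_max_exp_sub_exp_eq_indicator, integrable_indicator_iff measurableSet_Ioi]
  exact (integrableOn_exp_mul_complex_Ioi (by simp; linarith) z).sub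
    ((integrableOn_exp_mul_complex_Ioi (by linarith) z).const_mul _)

lemma integral_cexp_mul_max_exp_sub_exp {a : ℂ} (ha : a.re < -1) (z : ℝ) :
    ∫ k : ℝ, Complex.exp (a * k) * ((max (Real.exp k - Real.exp z) 0 : ℝ) : ℂ) =
      1 / (a * (a + 1)) * Complex.exp ((a + 1) * z) := by
  have hre : a.re < 0 := by linarith
  have hre' : (a + 1).re < 0 := by simp; linarith
  have h0 : a ≠ 0 := fun h => by simp [h] at hre
  have h1 : a + 1 ≠ 0 := fun h => by simp [h] at hre'
  rw [cexp_mul_max_exp_sub_exp_eq_indicator, integral_indicator measurableSet_Ioi,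
    integral_sub (integrableOn_exp_mul_complex_Ioi hre' z)
      ((integrableOn_exp_mul_complex_Ioi hre z).const_mul _),
    integral_const_mul, integral_exp_mul_complex_Ioi hre', integral_exp_mul_complex_Ioi hre,
    add_mul, one_mul, Complex.exp_add]
  field_simp
  ring

lemma integral_exp_mul_max_exp_sub_exp {b : ℝ} (hb : b < -1) (z : ℝ) :
    ∫ k : ℝ, Real.exp (b * k) * max (Real.exp k - Real.exp z) 0 =
      1 / (b * (b + 1)) * Real.exp ((b + 1) * z) := by
  have h := integral_cexp_mul_max_exp_sub_exp (a := (b : ℂ)) (by simpa using hb) z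
  apply Complex.ofReal_injective
  rw [← integral_complex_ofReal]
  push_cast at h ⊢
  exact h

/-- The damped payoff weighted by `f` is integrable jointly in log-strike and log-wealth. -/
lemma integrable_prod_cexp_mul_max_exp_sub_exp_mul {a : ℂ} (ha : a.re < -1) {f : ℝ → ℝ}
    (hfm : Measurable f)
    (hfe : Integrable (fun z : ℝ => Real.exp ((a.re + 1) * z) * f z)) :
    Integrable (fun p : ℝ × ℝ => Complex.exp (a * p.1) *
      ((max (Real.exp p.1 - Real.exp p.2) 0 : ℝ) : ℂ) * ((f p.2 : ℝ) : ℂ))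
      (volume.prod volume) := by
  have hmeas : Measurable (fun p : ℝ × ℝ => Complex.exp (a * p.1) *
      ((max (Real.exp p.1 - Real.exp p.2) 0 : ℝ) : ℂ) * ((f p.2 : ℝ) : ℂ)) := by
    fun_prop
  rw [integrable_prod_iff' hmeas.aestronglyMeasurable]
  refine ⟨.of_forall fun z => (integrable_cexp_mul_max_exp_sub_exp ha z).mul_const (f z : ℂ), ?_⟩
  have hnorm (z : ℝ) : ∫ k : ℝ, ‖Complex.exp (a * k) *
      ((max (Real.exp k - Real.exp z) 0 : ℝ) : ℂ) * ((f z : ℝ) : ℂ)‖ =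
      1 / (a.re * (a.re + 1)) * ‖Real.exp ((a.re + 1) * z) * f z‖ := by
    have hpoint (k : ℝ) : ‖Complex.exp (a * k) *
        ((max (Real.exp k - Real.exp z) 0 : ℝ) : ℂ) * ((f z : ℝ) : ℂ)‖ =
        Real.exp (a.re * k) * max (Real.exp k - Real.exp z) 0 * ‖f z‖ := by
      rw [norm_mul, norm_mul, Complex.norm_exp, Complex.norm_real, Complex.norm_real,
        Real.norm_of_nonneg (le_max_right _ _), Complex.re_mul_ofReal]
    simp_rw [hpoint]
    rw [integral_mul_const, integral_exp_mul_max_exp_sub_exp ha, norm_mul,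
      Real.norm_of_nonneg (Real.exp_pos _).le, mul_assoc]
  simp_rw [hnorm]
  exact hfe.norm.const_mul _

/-- Fubini computation underlying the Carr–Madan formula for a plain-vanilla option in
log-strike variables, with the denominator `α² − α − u² + iu(1 − 2α)`. -/
theorem stmt_18
    (α : ℝ) (hα : 1 < α) (f : ℝ → ℝ) (hfm : Measurable f) (hf0 : ∀ z : ℝ, 0 ≤ f z)
    (hfe : Integrable (fun z : ℝ => Real.exp ((1 - α) * z) * f z)) :
    ∀ u : ℝ,
      Integrable (fun k : ℝ =>
        Complex.exp (((u : ℂ) * Complex.I - (α : ℂ)) * (k : ℂ)) *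
          (((∫ z : ℝ, max (Real.exp k - Real.exp z) 0 * f z) : ℝ) : ℂ)) ∧
      (∫ k : ℝ, Complex.exp (((u : ℂ) * Complex.I - (α : ℂ)) * (k : ℂ)) *
          (((∫ z : ℝ, max (Real.exp k - Real.exp z) 0 * f z) : ℝ) : ℂ))
        = (1 / (((α : ℂ) - (u : ℂ) * Complex.I) * ((α : ℂ) - 1 - (u : ℂ) * Complex.I))) *
            ∫ z : ℝ, Complex.exp (((u : ℂ) * Complex.I - (α : ℂ) + 1) * (z : ℂ)) * ((f z : ℝ) : ℂ) ∧
      ((α : ℂ) - (u : ℂ) * Complex.I) * ((α : ℂ) - 1 - (u : ℂ) * Complex.I)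
        = (α : ℂ) ^ 2 - (α : ℂ) - (u : ℂ) ^ 2 + (u : ℂ) * Complex.I * (1 - 2 * (α : ℂ)) := by
  intro u
  set a : ℂ := (u : ℂ) * Complex.I - (α : ℂ) with ha_def
  have hre : a.re = -α := by simp [ha_def]
  have ha : a.re < -1 := by linarith
  have hint := integrable_prod_cexp_mul_max_exp_sub_exp_mul ha hfm
    (by simpa only [hre, neg_add_eq_sub] using hfe)
  have hinner (k : ℝ) :
      Complex.exp (a * k) * (((∫ z : ℝ, max (Real.exp k - Real.exp z) 0 * f z) : ℝ) : ℂ) =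
        ∫ z : ℝ, Complex.exp (a * k) *
          ((max (Real.exp k - Real.exp z) 0 : ℝ) : ℂ) * ((f z : ℝ) : ℂ) := by
    rw [← integral_complex_ofReal, ← integral_const_mul]
    simp_rw [Complex.ofReal_mul, mul_assoc]
  have hden : ((α : ℂ) - (u : ℂ) * Complex.I) * ((α : ℂ) - 1 - (u : ℂ) * Complex.I) =
      a * (a + 1) := by
    rw [ha_def]
    ring
  simp_rw [hinner]
  refine ⟨hint.integral_prod_left, ?_, by linear_combination (u : ℂ) ^ 2 * Complex.I_sq⟩
  rw [integral_integral_swap hint, hden, ← integral_const_mul]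
  simp_rw [integral_mul_const, integral_cexp_mul_max_exp_sub_exp ha, mul_assoc]
end
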